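/- arXiv:1110.1030 — 2 statements merged into one kernel-verified Lean document; each statement's English description precedes it below -/
import Mathlib

section
/- Let n ≥ 1 and k ≥ 0 be integers, let h : ℝⁿ → ℂ be a harmonic polynomial homogeneous of degree k, and let ψ : (0,∞) → ℂ be twice differentiable. Then for every y ∈ ℝⁿ with y ≠ 0, Δ( y ↦ ψ(‖y‖)h(y) )(y) = ψ''(‖y‖) h(y) + (n−1+2k) ψ'(‖y‖) h(y) / ‖y‖; equivalently, ‖y‖² Δ(ψ(‖·‖)h)(y) = ‖y‖² ψ''(‖y‖) h(y) + (n−1+2k) ‖y‖ ψ'(‖y‖) h(y). -/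
noncomputable section

/-- `n`-dimensional Euclidean space. -/
abbrev E (n : ℕ) := EuclideanSpace ℝ (Fin n)

/-- Partial derivative in the `j`-th coordinate direction. -/
noncomputable def pd {n : ℕ} (j : Fin n) (f : E n → ℂ) (y : E n) : ℂ :=
  fderiv ℝ f y (EuclideanSpace.single j 1)

/-- The Laplacian `Δ = ∑ⱼ ∂²/∂yⱼ²`. -/
noncomputable def lap {n : ℕ} (f : E n → ℂ) (y : E n) : ℂ :=
  ∑ j : Fin n, pd j (pd j f) y

/-- `h : ℝⁿ → ℂ` is a harmonic polynomial, homogeneous of degree `k`: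
it is given by a polynomial in the coordinates, `h (t • y) = t^k * h y`,
and `Δ h = 0`. -/
def IsHarmonicHomog {n : ℕ} (k : ℕ) (h : E n → ℂ) : Prop :=
  (∃ p : MvPolynomial (Fin n) ℂ, ∀ y : E n, h y = MvPolynomial.eval (fun j => ((y j : ℝ) : ℂ)) p) ∧
  (∀ (t : ℝ) (y : E n), h (t • y) = (t : ℂ) ^ k * h y) ∧
  (∀ y : E n, lap h y = 0)

lemma pd_congr {n : ℕ} (j : Fin n) {f g : E n → ℂ} {y : E n} (hfg : f =ᶠ[nhds y] g) :
    pd j f y = pd j g y := by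
  simp only [pd, hfg.fderiv_eq]

lemma pd_add {n : ℕ} (j : Fin n) {f g : E n → ℂ} {y : E n}
    (hf : DifferentiableAt ℝ f y) (hg : DifferentiableAt ℝ g y) :
    pd j (fun z => f z + g z) y = pd j f y + pd j g y := by
  simp only [pd, fderiv_fun_add hf hg, add_apply]

/-- The product rule in a coordinate direction. -/
lemma pd_mul {n : ℕ} (j : Fin n) {f g : E n → ℂ} {y : E n}
    (hf : DifferentiableAt ℝ f y) (hg : DifferentiableAt ℝ g y) :
    pd j (fun z => f z * g z) y = pd j f y * g y + f y * pd j g y := by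
  simp only [pd, fderiv_fun_mul hf hg, add_apply,
    smul_apply, smul_eq_mul]
  ring

lemma hasFDerivAt_ofReal_coord {n : ℕ} (j : Fin n) (y : E n) :
    HasFDerivAt (fun z : E n => ((z j : ℝ) : ℂ))
      (Complex.ofRealCLM.comp (EuclideanSpace.proj j : E n →L[ℝ] ℝ)) y :=
  (Complex.ofRealCLM.comp (EuclideanSpace.proj j : E n →L[ℝ] ℝ)).hasFDerivAt

lemma pd_coord {n : ℕ} (j : Fin n) (y : E n) :
    pd j (fun z : E n => ((z j : ℝ) : ℂ)) y = 1 := by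
  simp [pd, (hasFDerivAt_ofReal_coord j y).fderiv]

lemma differentiableAt_radial {n : ℕ} {φ : ℝ → ℂ} {y : E n} (hy : y ≠ 0)
    (hφ : DifferentiableAt ℝ φ ‖y‖) : DifferentiableAt ℝ (fun z : E n => φ ‖z‖) y :=
  hφ.comp y (differentiableAt_id.norm ℝ hy)

lemma pd_radial {n : ℕ} (j : Fin n) {φ : ℝ → ℂ} {y : E n} (hy : y ≠ 0)
    (hφ : DifferentiableAt ℝ φ ‖y‖) :
    pd j (fun z : E n => φ ‖z‖) y = deriv φ ‖y‖ / (‖y‖ : ℂ) * ((y j : ℝ) : ℂ) := by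
  have hpos : ‖y‖ ≠ 0 := norm_ne_zero_iff.2 hy
  have hsq := (hasStrictFDerivAt_norm_sq y).hasFDerivAt.sqrt (pow_ne_zero 2 hpos)
  simp only [Real.sqrt_sq (norm_nonneg _)] at hsq
  have hcomp := hφ.hasFDerivAt.comp y hsq
  have hfd : fderiv ℝ (fun z : E n => φ ‖z‖) y = _ := hcomp.fderiv
  rw [pd, hfd]
  have hpos' : (‖y‖ : ℂ) ≠ 0 := by exact_mod_cast hpos
  simp [fderiv_eq_smul_deriv, EuclideanSpace.inner_single_right]
  field_simp

/-- Euler's identity for homogeneous functions. -/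
lemma sum_coord_mul_pd {n k : ℕ} {h : E n → ℂ} {y : E n}
    (hom : ∀ (t : ℝ) (y : E n), h (t • y) = (t : ℂ) ^ k * h y)
    (hd : DifferentiableAt ℝ h y) :
    ∑ j : Fin n, ((y j : ℝ) : ℂ) * pd j h y = k * h y := by
  have hsum : ∑ j : Fin n, y j • EuclideanSpace.single j (1 : ℝ) = y := by
    ext i
    simp [Pi.single_apply]
  have hcurve : HasDerivAt (fun t : ℝ => t • y) y 1 := by
    simpa using (hasDerivAt_id (1 : ℝ)).smul_const y
  have hleft : HasDerivAt (fun t : ℝ => h (t • y)) (fderiv ℝ h y y) 1 := by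
    have hd' : HasFDerivAt h (fderiv ℝ h y) ((1 : ℝ) • y) := by
      rw [one_smul]
      exact hd.hasFDerivAt
    exact hd'.comp_hasDerivAt 1 hcurve
  have hright : HasDerivAt (fun t : ℝ => h (t • y)) (k * h y) 1 := by
    simp only [hom]
    simpa using ((hasDerivAt_id (1 : ℝ)).ofReal_comp.fun_pow k).mul_const (h y)
  rw [← hleft.unique hright]
  conv_rhs => rw [← hsum, map_sum, hsum]
  simp [pd]

lemma contDiff_of_eq_eval {n : ℕ} {h : E n → ℂ} (p : MvPolynomial (Fin n) ℂ)
    (hp : ∀ y : E n, h y = MvPolynomial.eval (fun j => ((y j : ℝ) : ℂ)) p) :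
    ContDiff ℝ 2 h := by
  have hcoord (j : Fin n) : ContDiff ℝ 2 (fun z : E n => ((z j : ℝ) : ℂ)) :=
    (Complex.ofRealCLM.comp (EuclideanSpace.proj j : E n →L[ℝ] ℝ)).contDiff
  rw [funext hp]
  simp only [MvPolynomial.eval_eq]
  exact ContDiff.sum fun d _ => contDiff_const.mul (contDiff_prod fun j _ => (hcoord j).pow _)

lemma ContDiff.differentiable_pd {n : ℕ} {h : E n → ℂ} (hh : ContDiff ℝ 2 h) (j : Fin n) :
    Differentiable ℝ (pd j h) :=
  ((hh.fderiv_right (m := 1) (by norm_num)).differentiable (by norm_num)).clm_apply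
    (differentiable_const _)

lemma sum_ofReal_coord_sq {n : ℕ} (y : E n) :
    ∑ j : Fin n, ((y j : ℝ) : ℂ) ^ 2 = (‖y‖ : ℂ) ^ 2 := by
  exact_mod_cast (EuclideanSpace.real_norm_sq_eq y).symm

/-- For `h` a harmonic polynomial homogeneous of degree `k` and `ψ` twice
differentiable on `(0,∞)`, for `y ≠ 0`,
`Δ(ψ(‖·‖)h)(y) = ψ''(‖y‖)h(y) + (n-1+2k)ψ'(‖y‖)h(y)/‖y‖`. -/
theorem stmt7 (n k : ℕ) (hn : 1 ≤ n) (h : E n → ℂ) (hh : IsHarmonicHomog k h)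
    (ψ : ℝ → ℂ)
    (hψ1 : ∀ ρ : ℝ, 0 < ρ → DifferentiableAt ℝ ψ ρ)
    (hψ2 : ∀ ρ : ℝ, 0 < ρ → DifferentiableAt ℝ (deriv ψ) ρ)
    (y : E n) (hy : y ≠ 0) :
    lap (fun z : E n => ψ ‖z‖ * h z) y =
      deriv (deriv ψ) ‖y‖ * h y
        + ((n : ℂ) - 1 + 2 * (k : ℂ)) * deriv ψ ‖y‖ * h y / ((‖y‖ : ℝ) : ℂ) := by
  obtain ⟨⟨p, hp⟩, hom, harm⟩ := hh
  have hC := contDiff_of_eq_eval p hp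
  have hd : Differentiable ℝ h := hC.differentiable (by norm_num)
  have hpos : 0 < ‖y‖ := norm_pos_iff.2 hy
  have hr : (‖y‖ : ℂ) ≠ 0 := by exact_mod_cast hpos.ne'
  let χ : ℝ → ℂ := fun ρ => deriv ψ ρ / (ρ : ℂ)
  have hχ : HasDerivAt χ
      ((deriv (deriv ψ) ‖y‖ * ‖y‖ - deriv ψ ‖y‖ * 1) / (‖y‖ : ℂ) ^ 2) ‖y‖ :=
    (hψ2 _ hpos).hasDerivAt.fun_div (hasDerivAt_id ‖y‖).ofReal_comp hr
  have first (j : Fin n) : pd j (fun z : E n => ψ ‖z‖ * h z) =ᶠ[nhds y]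
      fun z => χ ‖z‖ * (((z j : ℝ) : ℂ) * h z) + ψ ‖z‖ * pd j h z := by
    filter_upwards [isOpen_ne.mem_nhds hy] with z hz
    have hψz := hψ1 _ (norm_pos_iff.2 hz)
    rw [pd_mul j (differentiableAt_radial hz hψz) (hd z), pd_radial j hz hψz]
    ring
  have second (j : Fin n) : pd j (pd j (fun z : E n => ψ ‖z‖ * h z)) y =
      deriv χ ‖y‖ / ‖y‖ * h y * ((y j : ℝ) : ℂ) ^ 2 + χ ‖y‖ * h y
        + 2 * χ ‖y‖ * (((y j : ℝ) : ℂ) * pd j h y) + ψ ‖y‖ * pd j (pd j h) y := by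
    have hc := (hasFDerivAt_ofReal_coord j y).differentiableAt
    have hχd := differentiableAt_radial hy hχ.differentiableAt
    have hψd := differentiableAt_radial hy (hψ1 _ hpos)
    have hpd := hC.differentiable_pd j y
    rw [pd_congr j (first j), pd_add j (hχd.fun_mul (hc.fun_mul (hd y))) (hψd.fun_mul hpd),
      pd_mul j hχd (hc.fun_mul (hd y)), pd_mul j hψd hpd, pd_mul j hc (hd y), pd_coord,
      pd_radial j hy hχ.differentiableAt, pd_radial j hy (hψ1 _ hpos)]
    simp only [χ]
    ring
  have hlap : ∑ j : Fin n, pd j (pd j h) y = 0 := harm y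
  simp only [lap, second, Finset.sum_add_distrib, ← Finset.mul_sum, sum_ofReal_coord_sq,
    sum_coord_mul_pd hom (hd y), hlap, hχ.deriv, χ]
  simp only [Finset.sum_const, Finset.card_univ, Fintype.card_fin, nsmul_eq_mul]
  field_simp
  ring

end
end

section
/- Let n ≥ 3, k ≥ 0, l ≥ 1 be integers, m ∈ ℤ, s ∈ ℂ, let h : ℝⁿ → ℂ be a harmonic polynomial homogeneous of degree k, and fix j ∈ {1,…,n}. Set h⁺_j(y) := y_j h(y) − (1/(2k+n−2)) ‖y‖² (∂h/∂y_j)(y), which is a harmonic polynomial homogeneous of degree k+1, and note that ∂h/∂y_j is a harmonic polynomial homogeneous of degree k−1. Then for all (θ,y) ∈ ℝ × ℝⁿ: e^{−iθ}( i (∂F_{m,l,k}[h]/∂y_j)(θ,y) − 2s y_j F_{m,l,k}[h](θ,y) ) = 2il · F_{m+2,l−1,k+1}[h⁺_j](θ,y) − s·( (2l+2k+n−2)(m+2k+4l+n) / (2(k+2l+n/2−1)(k+2l+n/2)) ) · F_{m+2,l,k+1}[h⁺_j](θ,y) + (i/(2k+n−2))·( (2l+2k+n−2) · F_{m+2,l,k−1}[∂h/∂y_j](θ,y)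 + ( 2isl(m+2k+4l+n) / (2(k+2l+n/2−1)(k+2l+n/2)) ) · F_{m+2,l+1,k−1}[∂h/∂y_j](θ,y) ). -/
noncomputable section

/-- Confluent hypergeometric function of the first kind
`₁F₁(a,b,z) = ∑ⱼ (a)ⱼ/(b)ⱼ · zʲ/j!`. -/
noncomputable def oneF1 (a b z : ℂ) : ℂ :=
  ∑' j : ℕ, ((ascPochhammer ℂ j).eval a / (ascPochhammer ℂ j).eval b) * z ^ j / (j.factorial : ℂ)

/-- The `K`-finite vector
`F_{m,l,k}[h](θ,y) = e^{-imθ/2} e^{-is‖y‖²} ‖y‖^{2l} h(y) ₁F₁((m+4l+2k+n)/4, 2l+k+n/2, 2is‖y‖²)`. -/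
noncomputable def Fm (n : ℕ) (s : ℂ) (m : ℤ) (l : ℕ) (k : ℤ) (h : E n → ℂ)
    (θ : ℝ) (y : E n) : ℂ :=
  Complex.exp (-Complex.I * (m : ℂ) * (θ : ℂ) / 2) *
    Complex.exp (-Complex.I * s * ((‖y‖ : ℝ) : ℂ) ^ 2) * ((‖y‖ : ℝ) : ℂ) ^ (2 * l) * h y *
    oneF1 (((m : ℂ) + 4 * (l : ℂ) + 2 * (k : ℂ) + (n : ℂ)) / 4)
      (2 * (l : ℂ) + (k : ℂ) + (n : ℂ) / 2)
      (2 * Complex.I * s * ((‖y‖ : ℝ) : ℂ) ^ 2)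

/-- The `j`-th term of the series defining `oneF1 a b z`. -/
def oneF1Term (a b z : ℂ) (j : ℕ) : ℂ :=
  ((ascPochhammer ℂ j).eval a / (ascPochhammer ℂ j).eval b) * z ^ j / (j.factorial : ℂ)

lemma ascPochhammer_eval_succ_left (a : ℂ) (j : ℕ) :
    (ascPochhammer ℂ (j + 1)).eval a = a * (ascPochhammer ℂ j).eval (a + 1) := by
  simp [ascPochhammer_succ_left]

lemma oneF1Term_succ (a b z : ℂ) (j : ℕ) :
    oneF1Term a b z (j + 1) = oneF1Term a b z j * ((a + j) * z / ((b + j) * (j + 1))) := by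
  simp only [oneF1Term, ascPochhammer_succ_eval, Nat.factorial_succ, Nat.cast_mul, Nat.cast_add,
    Nat.cast_one, pow_succ, div_eq_mul_inv, mul_inv]
  ring

lemma norm_oneF1Term_succ_le (a b z : ℂ) {j : ℕ} (hj : 2 * ‖b‖ + ‖a‖ + 8 * ‖z‖ ≤ j) :
    ‖oneF1Term a b z (j + 1)‖ ≤ 1 / 2 * ‖oneF1Term a b z j‖ := by
  have ha : ‖a + j‖ ≤ ‖a‖ + j := by simpa using norm_add_le a (j : ℂ)
  have hb : (j : ℝ) - ‖b‖ ≤ ‖b + j‖ := by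
    have := norm_sub_le (b + j) b
    simp only [add_sub_cancel_left, Complex.norm_natCast] at this
    linarith
  have hj1 : ‖(j : ℂ) + 1‖ = j + 1 := by exact_mod_cast Complex.norm_natCast (j + 1)
  have hna := norm_nonneg a
  have hnb := norm_nonneg b
  have hnz := norm_nonneg z
  rw [oneF1Term_succ, norm_mul, mul_comm]
  refine mul_le_mul_of_nonneg_right ?_ (norm_nonneg _)
  rw [norm_div, norm_mul, norm_mul, hj1]
  refine div_le_of_le_mul₀ (by positivity) (by norm_num) ?_
  have h₁ : ‖a + j‖ * ‖z‖ ≤ (2 * j) * (j / 8) := by gcongr <;> linarith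
  have h₂ : (j / 2 : ℝ) * (j + 1) ≤ ‖b + j‖ * (j + 1) := by gcongr; linarith
  have h₃ : (0 : ℝ) ≤ j := j.cast_nonneg
  nlinarith

lemma summable_oneF1Term (a b z : ℂ) : Summable (oneF1Term a b z) := by
  refine summable_of_ratio_norm_eventually_le (r := 1 / 2) (by norm_num) ?_
  filter_upwards [Filter.eventually_ge_atTop ⌈2 * ‖b‖ + ‖a‖ + 8 * ‖z‖⌉₊] with j hj
  exact norm_oneF1Term_succ_le a b z (Nat.ceil_le.mp hj)

lemma hasSum_oneF1 (a b z : ℂ) : HasSum (oneF1Term a b z) (oneF1 a b z) :=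
  (summable_oneF1Term a b z).hasSum

lemma hasDerivAt_oneF1Term_succ (a b z : ℂ) (j : ℕ) :
    HasDerivAt (fun w => oneF1Term a b w (j + 1)) (a / b * oneF1Term (a + 1) (b + 1) z j) z := by
  have h := (((hasDerivAt_pow (j + 1) z).const_mul ((ascPochhammer ℂ (j + 1)).eval a /
    (ascPochhammer ℂ (j + 1)).eval b)).div_const ((j + 1).factorial : ℂ))
  refine h.congr_deriv ?_
  have hj : (j : ℂ) + 1 ≠ 0 := j.cast_add_one_ne_zero
  have hf : (j.factorial : ℂ) ≠ 0 := by exact_mod_cast j.factorial_ne_zero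
  simp only [oneF1Term, ascPochhammer_eval_succ_left, mul_div_mul_comm, Nat.factorial_succ,
    Nat.cast_mul, Nat.cast_add, Nat.cast_one, Nat.add_sub_cancel]
  field_simp

lemma hasDerivAt_oneF1 (a b z : ℂ) :
    HasDerivAt (oneF1 a b) (a / b * oneF1 (a + 1) (b + 1) z) z := by
  set R : ℝ := ‖z‖ + 1 with hR
  have hz : z ∈ Metric.ball (0 : ℂ) R := by simp [hR]
  have hu : Summable fun j => ‖a / b‖ * ‖oneF1Term (a + 1) (b + 1) (R : ℂ) j‖ :=
    (summable_oneF1Term _ _ _).norm.mul_left _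
  have hbound : ∀ (j : ℕ) (w : ℂ), w ∈ Metric.ball (0 : ℂ) R →
      ‖a / b * oneF1Term (a + 1) (b + 1) w j‖ ≤
        ‖a / b‖ * ‖oneF1Term (a + 1) (b + 1) (R : ℂ) j‖ := by
    intro j w hw
    have hwR : ‖w‖ ≤ ‖(R : ℂ)‖ := by
      rw [Complex.norm_real]
      exact (mem_ball_zero_iff.mp hw).le.trans (le_abs_self R)
    simp only [oneF1Term, norm_mul, norm_div, norm_pow]
    gcongr
  have h := hasDerivAt_tsum_of_isPreconnected hu Metric.isOpen_ball
    (convex_ball (0 : ℂ) R).isPreconnected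
    (fun j w _ => hasDerivAt_oneF1Term_succ a b w j) hbound hz
    ((summable_nat_add_iff 1).mpr (summable_oneF1Term a b z)) hz
  rw [tsum_mul_left, (hasSum_oneF1 (a + 1) (b + 1) z).tsum_eq] at h
  have hsplit : oneF1 a b = fun w => 1 + ∑' j, oneF1Term a b w (j + 1) := by
    funext w
    rw [← (hasSum_oneF1 a b w).tsum_eq, (summable_oneF1Term a b w).tsum_eq_zero_add]
    simp [oneF1Term]
  rw [hsplit]
  exact h.const_add 1

/-- The contiguity relation
`₁F₁(a,c,z) - ₁F₁(a,c+1,z) = (a z / (c (c+1))) ₁F₁(a+1,c+2,z)`. -/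
lemma oneF1_contiguous (a c z : ℂ) (hc : ∀ j : ℕ, c + j ≠ 0) :
    oneF1 a c z = oneF1 a (c + 1) z + a * z / (c * (c + 1)) * oneF1 (a + 1) (c + 2) z := by
  have hterm : ∀ j, oneF1Term a c z (j + 1) - oneF1Term a (c + 1) z (j + 1) =
      a * z / (c * (c + 1)) * oneF1Term (a + 1) (c + 2) z j := by
    intro j
    have hp : (ascPochhammer ℂ j).eval (c + 2) * (c + 1) =
        (ascPochhammer ℂ j).eval (c + 1) * (c + 1 + j) := by
      rw [← ascPochhammer_succ_eval, ascPochhammer_eval_succ_left, mul_comm,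
        add_assoc, one_add_one_eq_two]
    have hc0 : c ≠ 0 := by simpa using hc 0
    have hc1 : c + 1 ≠ 0 := by simpa using hc 1
    have hcj : c + 1 + j ≠ 0 := by simpa [add_assoc, add_comm (1 : ℂ)] using hc (j + 1)
    have hne : (ascPochhammer ℂ j).eval (c + 2) ≠ 0 := by
      rw [Ne, ascPochhammer_eval_eq_zero_iff]
      rintro ⟨i, -, hi⟩
      apply hc (i + 2)
      push_cast
      linear_combination hi
    have hj : (j : ℂ) + 1 ≠ 0 := j.cast_add_one_ne_zero
    have hf : (j.factorial : ℂ) ≠ 0 := by exact_mod_cast j.factorial_ne_zero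
    have h₁ : (ascPochhammer ℂ j).eval (c + 1) =
        (ascPochhammer ℂ j).eval (c + 2) * (c + 1) / (c + 1 + j) := by
      rw [hp]; field_simp
    simp only [oneF1Term, ascPochhammer_eval_succ_left, Nat.factorial_succ, Nat.cast_mul,
      Nat.cast_add, Nat.cast_one, add_assoc c 1 1, one_add_one_eq_two, h₁]
    field_simp
    ring
  have hd := ((hasSum_oneF1 a c z).sub (hasSum_oneF1 a (c + 1) z))
  have hs := (hasSum_nat_add_iff' 1).mpr hd
  simp only [hterm] at hs
  have h := hs.unique ((hasSum_oneF1 (a + 1) (c + 2) z).mul_left _)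
  simp only [Finset.range_one, Finset.sum_singleton, oneF1Term, ascPochhammer_zero,
    Polynomial.eval_one, sub_self, sub_zero] at h
  linear_combination h

lemma differentiable_eval_coord {n : ℕ} (p : MvPolynomial (Fin n) ℂ) :
    Differentiable ℝ fun y : E n => MvPolynomial.eval (fun j => ((y j : ℝ) : ℂ)) p := by
  induction p using MvPolynomial.induction_on with
  | C a => simp
  | add p q hp hq => simpa using hp.fun_add hq
  | mul_X p i hp =>
    have hi : Differentiable ℝ fun y : E n => ((y i : ℝ) : ℂ) :=
      Complex.ofRealCLM.differentiable.comp (EuclideanSpace.proj (𝕜 := ℝ) i).differentiable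
    simpa using hp.fun_mul hi

/-- The derivative in the `j`-th direction of a function of the form `G(‖y‖²) h(y)`. -/
lemma pd_radial_mul {n : ℕ} (j : Fin n) {G : ℂ → ℂ} {G' : ℂ} {h : E n → ℂ} {y : E n}
    (hG : HasDerivAt G G' (((‖y‖ : ℝ) : ℂ) ^ 2)) (hh : DifferentiableAt ℝ h y) :
    pd j (fun y' : E n => G (((‖y'‖ : ℝ) : ℂ) ^ 2) * h y') y =
      2 * ((y j : ℝ) : ℂ) * G' * h y + G (((‖y‖ : ℝ) : ℂ) ^ 2) * pd j h y := by
  have hr : HasFDerivAt (fun y' : E n => ((‖y'‖ : ℝ) : ℂ) ^ 2)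
      (Complex.ofRealCLM.comp (2 • innerSL ℝ y)) y := by
    have := Complex.ofRealCLM.hasFDerivAt.comp y (hasStrictFDerivAt_norm_sq y).hasFDerivAt
    refine this.congr_of_eventuallyEq (.of_forall fun y' => ?_)
    simp
  have hc := (hG.hasFDerivAt.restrictScalars ℝ).comp y hr
  have hm := hc.mul hh.hasFDerivAt
  have hi : inner ℝ y (EuclideanSpace.single j 1) = y j := by
    simp [EuclideanSpace.inner_single_right]
  unfold pd
  rw [show (fun y' : E n => G (((‖y'‖ : ℝ) : ℂ) ^ 2) * h y') =
    (G ∘ fun y' : E n => ((‖y'‖ : ℝ) : ℂ) ^ 2) * h from rfl, hm.fderiv]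
  simp [hi]
  ring

lemma hasDerivAt_radial_profile (C s a b w : ℂ) (l : ℕ) :
    HasDerivAt
      (fun w => C * Complex.exp (-Complex.I * s * w) * w ^ l * oneF1 a b (2 * Complex.I * s * w))
      (C * Complex.exp (-Complex.I * s * w) *
        ((-Complex.I * s * w ^ l + l * w ^ (l - 1)) * oneF1 a b (2 * Complex.I * s * w) +
          2 * Complex.I * s * w ^ l * (a / b * oneF1 (a + 1) (b + 1) (2 * Complex.I * s * w)))) w := by
  have hlin : ∀ c : ℂ, HasDerivAt (fun w => c * w) c w := fun c => by
    simpa using (hasDerivAt_id w).const_mul c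
  have hF := (hasDerivAt_oneF1 a b (2 * Complex.I * s * w)).comp w (hlin (2 * Complex.I * s))
  refine ((((hlin (-Complex.I * s)).cexp.const_mul C).mul (hasDerivAt_pow l w)).mul
    hF).congr_deriv ?_
  simp only [Pi.mul_apply, Function.comp_apply]
  ring

lemma pd_Fm {n : ℕ} (s : ℂ) (m : ℤ) (l : ℕ) (k : ℤ) {h : E n → ℂ} (θ : ℝ) {y : E n}
    (hh : DifferentiableAt ℝ h y) (j : Fin n) {w a b C : ℂ} (hw : w = ((‖y‖ : ℝ) : ℂ) ^ 2)
    (ha : a = ((m : ℂ) + 4 * (l : ℂ) + 2 * (k : ℂ) + (n : ℂ)) / 4)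
    (hb : b = 2 * (l : ℂ) + (k : ℂ) + (n : ℂ) / 2)
    (hC : C = Complex.exp (-Complex.I * (m : ℂ) * (θ : ℂ) / 2)) :
    pd j (fun y' : E n => Fm n s m l k h θ y') y =
      2 * ((y j : ℝ) : ℂ) * (C * Complex.exp (-Complex.I * s * w) *
        ((-Complex.I * s * w ^ l + l * w ^ (l - 1)) * oneF1 a b (2 * Complex.I * s * w) +
          2 * Complex.I * s * w ^ l * (a / b * oneF1 (a + 1) (b + 1) (2 * Complex.I * s * w)))) *
        h y +
      C * Complex.exp (-Complex.I * s * w) * w ^ l * oneF1 a b (2 * Complex.I * s * w) *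
        pd j h y := by
  subst hw
  rw [← pd_radial_mul j (hasDerivAt_radial_profile C s a b _ l) hh]
  congr 1
  funext y'
  simp only [Fm, ha, hb, hC, pow_mul]
  ring

/-- The Heisenberg algebra action of `E_j⁺` on `F_{m,l,k}[h]`:
`E_j⁺.F_{m,l,k}[h] = 2il F_{m+2,l-1,k+1}[h⁺ⱼ]
  - s((2l+2k+n-2)(m+2k+4l+n)/(2(k+2l+n/2-1)(k+2l+n/2))) F_{m+2,l,k+1}[h⁺ⱼ]
  + (i/(2k+n-2)) ((2l+2k+n-2) F_{m+2,l,k-1}[∂ⱼh]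
    + (2isl(m+2k+4l+n)/(2(k+2l+n/2-1)(k+2l+n/2))) F_{m+2,l+1,k-1}[∂ⱼh])`,
where `h⁺ⱼ(y) = yⱼ h(y) - (1/(2k+n-2)) ‖y‖² ∂ⱼh(y)`. -/
theorem stmt16 (n k l : ℕ) (hn : 3 ≤ n) (hl : 1 ≤ l) (m : ℤ) (s : ℂ)
    (h : E n → ℂ) (hh : IsHarmonicHomog k h) (j : Fin n)
    (hp : E n → ℂ)
    (hhp : ∀ y : E n, hp y =
      ((y j : ℝ) : ℂ) * h y - 1 / (2 * (k : ℂ) + (n : ℂ) - 2) * ((‖y‖ : ℝ) : ℂ) ^ 2 * pd j h y)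
    (θ : ℝ) (y : E n) :
    Complex.exp (-Complex.I * (θ : ℂ)) *
        (Complex.I * pd j (fun y' : E n => Fm n s m l (k : ℤ) h θ y') y
          - 2 * s * ((y j : ℝ) : ℂ) * Fm n s m l (k : ℤ) h θ y)
      = 2 * Complex.I * (l : ℂ) * Fm n s (m + 2) (l - 1) ((k : ℤ) + 1) hp θ y
        - s * ((2 * (l : ℂ) + 2 * (k : ℂ) + (n : ℂ) - 2) * ((m : ℂ) + 2 * (k : ℂ) + 4 * (l : ℂ) + (n : ℂ))
              / (2 * ((k : ℂ) + 2 * (l : ℂ) + (n : ℂ) / 2 - 1) * ((k : ℂ) + 2 * (l : ℂ) + (n : ℂ) / 2)))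
            * Fm n s (m + 2) l ((k : ℤ) + 1) hp θ y
        + Complex.I / (2 * (k : ℂ) + (n : ℂ) - 2) *
            ((2 * (l : ℂ) + 2 * (k : ℂ) + (n : ℂ) - 2)
                * Fm n s (m + 2) l ((k : ℤ) - 1) (fun y' : E n => pd j h y') θ y
              + 2 * Complex.I * s * (l : ℂ) * ((m : ℂ) + 2 * (k : ℂ) + 4 * (l : ℂ) + (n : ℂ))
                  / (2 * ((k : ℂ) + 2 * (l : ℂ) + (n : ℂ) / 2 - 1) * ((k : ℂ) + 2 * (l : ℂ) + (n : ℂ) / 2))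
                * Fm n s (m + 2) (l + 1) ((k : ℤ) - 1) (fun y' : E n => pd j h y') θ y) := by
  have hdiff : DifferentiableAt ℝ h y := by
    obtain ⟨p, hp⟩ := hh.1
    rw [funext hp]
    exact differentiable_eval_coord p y
  obtain ⟨l, rfl⟩ : ∃ l', l = l' + 1 := ⟨l - 1, by omega⟩
  obtain ⟨A, hA⟩ : ∃ A : ℂ, A = ((m : ℂ) + 4 * (l + 1) + 2 * k + n) / 4 := ⟨_, rfl⟩
  obtain ⟨c, hc⟩ : ∃ c : ℂ, c = 2 * (l + 1) + (k : ℂ) + n / 2 - 1 := ⟨_, rfl⟩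
  obtain ⟨D, hD⟩ : ∃ D : ℂ, D = 2 * (k : ℂ) + n - 2 := ⟨_, rfl⟩
  have hcj : ∀ i : ℕ, c + i ≠ 0 := by
    intro i hi
    have h0 : ((4 * l + 2 + 2 * k + n + 2 * i : ℕ) : ℂ) = 0 := by
      push_cast
      linear_combination 2 * hi - 2 * hc
    have := Nat.cast_eq_zero.mp h0
    omega
  have hc0 : c ≠ 0 := by simpa using hcj 0
  have hc1 : c + 1 ≠ 0 := by simpa using hcj 1
  have hD0 : D ≠ 0 := by
    intro h0
    have h1 : ((2 * k + n : ℕ) : ℂ) = (2 : ℕ) := by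
      push_cast
      linear_combination h0 - hD
    have := Nat.cast_injective h1
    omega
  rw [pd_Fm s m (l + 1) k θ hdiff j rfl (a := A) (b := c + 1) (by rw [hA]; push_cast; ring)
    (by rw [hc]; push_cast; ring) rfl]
  have hexp : Complex.exp (-Complex.I * ((m + 2 : ℤ) : ℂ) * θ / 2) =
      Complex.exp (-Complex.I * θ) * Complex.exp (-Complex.I * m * θ / 2) := by
    rw [← Complex.exp_add]
    congr 1
    push_cast
    ring
  have hm : (m : ℂ) + 2 * k + 4 * (l + 1) + n = 4 * A := by rw [hA]; ring
  have hlD : 2 * ((l : ℂ) + 1) + 2 * k + n - 2 = 2 * (l + 1) + D := by rw [hD]; ring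
  have hden0 : (k : ℂ) + 2 * (l + 1) + n / 2 - 1 = c := by rw [hc]; ring
  have hden1 : (k : ℂ) + 2 * (l + 1) + n / 2 = c + 1 := by rw [hc]; ring
  have hcD : c = 2 * (l + 1) + D / 2 := by rw [hc, hD]; ring
  have a0 : (((m + 2 : ℤ) : ℂ) + 4 * (l : ℂ) + 2 * (((k : ℤ) + 1 : ℤ) : ℂ) + n) / 4 = A := by
    rw [hA]; push_cast; ring
  have b0 : 2 * (l : ℂ) + (((k : ℤ) + 1 : ℤ) : ℂ) + n / 2 = c := by
    rw [hc]; push_cast; ring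
  have a1 : (((m + 2 : ℤ) : ℂ) + 4 * ((l + 1 : ℕ) : ℂ) + 2 * (((k : ℤ) + 1 : ℤ) : ℂ) + n) / 4 =
      A + 1 := by
    rw [hA]; push_cast; ring
  have b1 : 2 * ((l + 1 : ℕ) : ℂ) + (((k : ℤ) + 1 : ℤ) : ℂ) + n / 2 = c + 2 := by
    rw [hc]; push_cast; ring
  have a2 : (((m + 2 : ℤ) : ℂ) + 4 * ((l + 1 : ℕ) : ℂ) + 2 * (((k : ℤ) - 1 : ℤ) : ℂ) + n) / 4 =
      A := by
    rw [hA]; push_cast; ring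
  have b2 : 2 * ((l + 1 : ℕ) : ℂ) + (((k : ℤ) - 1 : ℤ) : ℂ) + n / 2 = c := by
    rw [hc]; push_cast; ring
  have a3 : (((m + 2 : ℤ) : ℂ) + 4 * ((l + 1 + 1 : ℕ) : ℂ) + 2 * (((k : ℤ) - 1 : ℤ) : ℂ) + n) / 4 =
      A + 1 := by
    rw [hA]; push_cast; ring
  have b3 : 2 * ((l + 1 + 1 : ℕ) : ℂ) + (((k : ℤ) - 1 : ℤ) : ℂ) + n / 2 = c + 2 := by
    rw [hc]; push_cast; ring
  have a4 : ((m : ℂ) + 4 * ((l + 1 : ℕ) : ℂ) + 2 * ((k : ℤ) : ℂ) + n) / 4 = A := by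
    rw [hA]; push_cast; ring
  have b4 : 2 * ((l + 1 : ℕ) : ℂ) + ((k : ℤ) : ℂ) + n / 2 = c + 1 := by
    rw [hc]; push_cast; ring
  simp only [Fm, hhp, Nat.add_sub_cancel, a0, b0, a1, b1, a2, b2, a3, b3, a4, b4, hexp, pow_mul,
    ← hD]
  rw [Nat.cast_add, Nat.cast_one, hm, hlD, hden0, hden1, show c + 1 + 1 = c + 2 by ring]
  generalize ((‖y‖ : ℝ) : ℂ) ^ 2 = w
  rw [oneF1_contiguous A c _ hcj]
  generalize oneF1 A (c + 1) _ = F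
  generalize oneF1 (A + 1) (c + 2) _ = F₁
  generalize Complex.exp (-Complex.I * s * w) = e₁
  generalize Complex.exp (-Complex.I * m * θ / 2) = e₂
  generalize Complex.exp (-Complex.I * θ) = e₃
  generalize pd j h y = P
  generalize h y = H
  generalize ((y j : ℝ) : ℂ) = x
  have hD' : D = 2 * (c - 2 * (l + 1)) := by rw [hcD]; ring
  have hE0 : c - 2 * (l + 1) ≠ 0 := fun h0 => hD0 (by rw [hD', h0, mul_zero])
  clear hD hc hcD
  subst hD'
  field_simp
  ring_nf
  simp only [Complex.I_sq]
  ring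

end
end
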